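/- For every n ≥ 3, the group IA(Fₙ) is not linear. -/

import Mathlib

/-!
STATEMENT 11: For every `n ≥ 3`, the group `IA(Fₙ)` is not linear.
-/

/-- `IA(Fₙ)`: the subgroup of `Aut(Fₙ)` of automorphisms acting trivially on the
abelianization, i.e. the kernel of the natural map `Aut(Fₙ) → Aut(Fₙᵃᵇ)`. -/
def IA (n : ℕ) : Subgroup (MulAut (FreeGroup (Fin n))) where
  carrier := {φ | ∀ x, Abelianization.of (φ x) = Abelianization.of x}
  one_mem' := fun _ => rfl
  mul_mem' := by
    intro a b ha hb x
    have h1 := ha (b x)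
    have h2 := hb x
    simpa [MulAut.mul_apply, h2] using h1
  inv_mem' := by
    intro a ha x
    have := ha (a⁻¹ x)
    simpa using this.symm

/-- `L` has a faithful finite-dimensional representation over the field `K`. -/
def HasFaithfulRep (L : Type*) [Group L] (K : Type) [Field K] : Prop :=
  ∃ (n : ℕ) (f : L →* GL (Fin n) K), Function.Injective f

/-- A group `L` is linear if it embeds in `GL(n, K)` for some field `K` and some `n`. -/
def IsLinear (L : Type*) [Group L] : Prop :=
  ∃ (K : Type) (inst : Field K), @HasFaithfulRep L _ K inst

theorem exists_characters_det {K A : Type*} [Field K] [IsAlgClosed K] [CommRing A] [Algebra K A]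
    (d : ℕ) : ∀ (V : Type) [AddCommGroup V] [Module K V] [Module A V] [IsScalarTower K A V]
      [FiniteDimensional K V], Module.finrank K V = d →
      ∃ s : Multiset (A →ₐ[K] K), s.card = d ∧
        ∀ a : A, LinearMap.det (Algebra.lsmul K K V a) = (s.map fun χ => χ a).prod := by
  induction d using Nat.strong_induction_on with
  | _ d ih =>
  intro V _ _ _ _ _ hd
  rcases subsingleton_or_nontrivial V with hV | hV
  · have : d = 0 := by rw [← hd]; exact Module.finrank_zero_of_subsingleton
    refine ⟨0, by simp [this], fun a => ?_⟩
    simp [LinearMap.det_eq_one_of_subsingleton]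
  have : IsArtinian A V := isArtinian_of_tower K inferInstance
  obtain ⟨W, hW⟩ := IsAtomic.exists_atom (Submodule A V)
  have : IsSimpleModule A W := isSimpleModule_iff_isAtom.mpr hW
  have : FiniteDimensional K W :=
    inferInstanceAs (FiniteDimensional K (W.restrictScalars K))
  have hbij := IsSimpleModule.algebraMap_end_bijective_of_isAlgClosed (A := A) (V := W) K
  let e : K ≃ₐ[K] Module.End A W := AlgEquiv.ofBijective (Algebra.ofId K _) hbij
  let χ : A →ₐ[K] K := e.symm.toAlgHom.comp (Algebra.lsmul K A W)
  have hχ : ∀ (a : A) (w : W), a • w = χ a • w := by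
    intro a w
    have h1 : e (χ a) = Algebra.lsmul K A W a := by simp [χ]
    have h2 : e (χ a) w = χ a • w := rfl
    rw [← h2, h1]; rfl
  have hfr : Module.finrank K (V ⧸ W) + Module.finrank K W = d := by
    rw [← hd]; exact Submodule.finrank_quotient_add_finrank (W.restrictScalars K)
  have hpos : 0 < Module.finrank K W := by
    have := hW.1
    have : Nontrivial W := (Submodule.nontrivial_iff_ne_bot).mpr this
    exact Module.finrank_pos
  have : FiniteDimensional K (V ⧸ W) :=
    inferInstanceAs (FiniteDimensional K (V ⧸ W.restrictScalars K))
  obtain ⟨s, hs, hdet⟩ := ih _ (by omega) (V ⧸ W) rfl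
  refine ⟨s + Multiset.replicate (Module.finrank K W) χ, by simp [hs, hfr], fun a => ?_⟩
  have hinv : W.restrictScalars K ≤ (W.restrictScalars K).comap (Algebra.lsmul K K V a) :=
    fun w hw => W.smul_mem a hw
  rw [LinearMap.det_eq_det_mul_det (W.restrictScalars K) _ hinv, Multiset.map_add,
    Multiset.prod_add, Multiset.map_replicate, Multiset.prod_replicate, mul_comm]
  congr 1
  · rw [← hdet a]
    rfl
  · have : LinearMap.restrict (p := W.restrictScalars K) (q := W.restrictScalars K)
        (Algebra.lsmul K K V a) (fun w hw => hinv hw) =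
        χ a • LinearMap.id := by
      ext w
      exact congrArg Subtype.val (hχ a w)
    refine (congrArg LinearMap.det this).trans ?_
    rw [LinearMap.det_smul, LinearMap.det_id, mul_one]
    rfl

theorem Subalgebra.exists_characters_det {K V : Type} [Field K] [IsAlgClosed K] [AddCommGroup V]
    [Module K V] [FiniteDimensional K V] (S : Subalgebra K (Module.End K V))
    (hS : ∀ x ∈ S, ∀ y ∈ S, x * y = y * x) :
    ∃ χ : Fin (Module.finrank K V) → (S →ₐ[K] K),
      ∀ a : S, LinearMap.det (a : Module.End K V) = ∏ i, χ i a := by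
  let _ : CommRing S := { S.toRing with mul_comm := fun x y => Subtype.ext (hS x x.2 y y.2) }
  obtain ⟨s, hs, hdet⟩ := _root_.exists_characters_det (K := K) (A := S) _ V rfl
  obtain ⟨l, rfl⟩ := Quotient.exists_rep s
  replace hs : l.length = Module.finrank K V := hs
  rw [← hs]
  refine ⟨l.get, fun a => ?_⟩
  refine (hdet a).trans ?_
  change (l.map fun χ => χ a).prod = _
  conv_lhs => rw [← List.ofFn_get l, List.map_ofFn, List.prod_ofFn]
  rfl

theorem Finset.exists_perm_of_map_univ_eq {ι γ : Type*} [Fintype ι] {f g : ι → γ}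
    (h : Finset.univ.val.map f = Finset.univ.val.map g) :
    ∃ σ : Equiv.Perm ι, ∀ i, f i = g (σ i) := by
  classical
  have hc : ∀ c, Fintype.card {i // f i = c} = Fintype.card {i // g i = c} := fun c => by
    have := congrArg (Multiset.count c) h
    simp only [Multiset.count_map] at this
    simp only [Fintype.card_subtype]
    simpa [Finset.card_def, eq_comm] using this
  exact ⟨Equiv.ofFiberEquiv fun c => Fintype.equivOfCardEq (hc c),
    fun i => (Equiv.ofFiberEquiv_map _ i).symm⟩

theorem exists_zsmul_eq_zero_of_forall_addMonoidHom {P : Type*} [AddCommGroup P] (x : P)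
    (h : ∀ v : P →+ ℚ, v x = 0) : ∃ m : ℕ, 0 < m ∧ m • x = 0 := by
  have h1 : (TensorProduct.mk ℤ ℚ P 1) x = 0 := by
    rw [← Module.forall_dual_apply_eq_zero_iff ℚ]
    intro φ
    exact h ((φ.toAddMonoidHom).comp (TensorProduct.mk ℤ ℚ P 1).toAddMonoidHom)
  rw [IsLocalizedModule.eq_zero_iff (nonZeroDivisors ℤ)] at h1
  obtain ⟨c, hc⟩ := h1
  refine ⟨(c : ℤ).natAbs, by simp, ?_⟩
  exact natAbs_nsmul_eq_zero.mpr hc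

theorem exists_pow_eq_one_of_stationary {G ι κ : Type*} [CommGroup G] [Fintype ι] [Fintype κ]
    [DecidableEq κ] (σ : Equiv.Perm ι) (k : ι → κ) (α β : ι → G)
    (hσ : ∀ i, α i * β i = β (σ i)) (hk : ∀ i j, k i = k j → β i = β j)
    (hα : ∀ c, ∏ i with k i = c, α i = 1) (i : ι) : ∃ m : ℕ, 0 < m ∧ α i ^ m = 1 := by
  refine exists_zsmul_eq_zero_of_forall_addMonoidHom (Additive.ofMul (α i)) fun v => ?_
  set a : ι → ℚ := fun i => v (Additive.ofMul (α i)) with ha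
  set b : ι → ℚ := fun i => v (Additive.ofMul (β i)) with hb
  have hab : ∀ i, a i + b i = b (σ i) := fun i => by
    simp only [ha, hb, ← map_add, ← ofMul_mul, hσ]
  have hcross : ∑ i, a i * b i = 0 := by
    rw [← Finset.sum_fiberwise _ k]
    refine Finset.sum_eq_zero fun c _ => ?_
    rcases (Finset.univ.filter fun i => k i = c).eq_empty_or_nonempty with h | ⟨j, hj⟩
    · simp [h]
    · have : ∑ i with k i = c, a i * b i = (∑ i with k i = c, a i) * b j := by
        rw [Finset.sum_mul]
        refine Finset.sum_congr rfl fun i hi => ?_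
        simp only [Finset.mem_filter, Finset.mem_univ, true_and] at hi hj
        simp only [hb, hk i j (hi.trans hj.symm)]
      rw [this]
      have h2 : ∑ i with k i = c, a i = 0 := by
        simp only [ha, ← map_sum, ← ofMul_prod, hα, ofMul_one, map_zero]
      rw [h2, zero_mul]
  have hsq : ∑ i, (a i + b i) ^ 2 = ∑ i, b i ^ 2 := by
    simp only [hab]
    exact Equiv.sum_comp σ fun i => b i ^ 2
  have h0 : ∑ i, a i ^ 2 = 0 := by
    have : ∑ i, (a i + b i) ^ 2 = ∑ i, a i ^ 2 + 2 * ∑ i, a i * b i + ∑ i, b i ^ 2 := by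
      rw [Finset.mul_sum, ← Finset.sum_add_distrib, ← Finset.sum_add_distrib]
      exact Finset.sum_congr rfl fun i _ => by ring
    linarith
  have := (Finset.sum_eq_zero_iff_of_nonneg fun i _ => sq_nonneg (a i)).mp h0 i (Finset.mem_univ i)
  exact pow_eq_zero_iff (two_ne_zero) |>.mp this

/-- The exponent in `exists_pow_eq_one_of_stationary` can be chosen uniformly. -/
theorem exists_uniform_pow_eq_one (G : Type*) [CommGroup G] [DecidableEq G]
    (ι : Type*) [Fintype ι] :
    ∃ m : ℕ, 0 < m ∧ ∀ (α β : ι → G) (σ : Equiv.Perm ι),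
      (∀ i, α i * β i = β (σ i)) →
      (∀ b, ∏ i with β i = b, α i = 1) → ∀ i, α i ^ m = 1 := by
  classical
  have key : ∀ p : Equiv.Perm ι × (ι → ι), ∃ m : ℕ, 0 < m ∧ ∀ α β : ι → G,
      (∀ i, α i * β i = β (p.1 i)) → (∀ i j, p.2 i = p.2 j → β i = β j) →
      (∀ c, ∏ i with p.2 i = c, α i = 1) → ∀ i, α i ^ m = 1 := by
    rintro ⟨σ, k⟩
    let S := {q : (ι → G) × (ι → G) // (∀ i, q.1 i * q.2 i = q.2 (σ i)) ∧
      (∀ i j, k i = k j → q.2 i = q.2 j) ∧ (∀ c, ∏ i with k i = c, q.1 i = 1)}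
    have := exists_pow_eq_one_of_stationary (G := S → G) σ k (fun i s => s.1.1 i)
      (fun i s => s.1.2 i) (fun i => funext fun s => s.2.1 i)
      (fun i j h => funext fun s => s.2.2.1 i j h)
      (fun c => funext fun s => by simpa using s.2.2.2 c)
    choose m hm hpow using this
    refine ⟨∏ i, m i, Finset.prod_pos fun i _ => hm i, fun α β h1 h2 h3 i => ?_⟩
    have := congrFun (hpow i) ⟨(α, β), h1, h2, h3⟩
    obtain ⟨c, hc⟩ := Finset.dvd_prod_of_mem m (Finset.mem_univ i)
    simp only [Pi.pow_apply, Pi.one_apply] at this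
    rw [hc, pow_mul, this, one_pow]
  choose m hm hpow using key
  refine ⟨∏ p, m p, Finset.prod_pos fun p _ => hm p, fun α β σ h1 h2 i => ?_⟩
  have : Nonempty ι := ⟨i⟩
  let k : ι → ι := fun i => Function.invFun β (β i)
  have hk : ∀ i, β (k i) = β i := fun i => Function.invFun_eq ⟨i, rfl⟩
  have := hpow (σ, k) α β h1 (fun i j (h : k i = k j) => by rw [← hk i, ← hk j, h]) (fun c => by
    by_cases hc : ∃ j, k j = c
    · obtain ⟨j, rfl⟩ := hc
      rw [← h2 (β j)]
      refine Finset.prod_congr (Finset.filter_congr fun i _ =>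
        ⟨fun (h : k i = k j) => ?_, fun h => ?_⟩) fun _ _ => rfl
      · rw [← hk i, ← hk j, h]
      · simp only [k, h]
    · rw [Finset.filter_false_of_mem fun i _ h => hc ⟨i, h⟩, Finset.prod_empty]) i
  obtain ⟨c, hc⟩ := Finset.dvd_prod_of_mem m (Finset.mem_univ (σ, k))
  rw [hc, pow_mul, this, one_pow]

open Polynomial in
theorem Subalgebra.charpoly_eq_prod_characters {K V ι : Type*} [Field K] [Infinite K]
    [AddCommGroup V] [Module K V] [FiniteDimensional K V] [Fintype ι]
    {S : Subalgebra K (Module.End K V)} {χ : ι → (S →ₐ[K] K)}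
    (hχ : ∀ a : S, LinearMap.det (a : Module.End K V) = ∏ i, χ i a) (a : S) :
    LinearMap.charpoly (a : Module.End K V) = ∏ i, (X - C (χ i a)) := by
  refine Polynomial.funext fun t => ?_
  have := hχ (algebraMap K S t - a)
  rw [LinearMap.eval_charpoly]
  simpa [Polynomial.eval_prod] using this

theorem LinearMap.charpoly_eq_of_semiconj {K V : Type*} [Field K] [Infinite K]
    [AddCommGroup V] [Module K V] [FiniteDimensional K V] {f g T : Module.End K V}
    (hT : IsUnit T) (h : T * f = g * T) : f.charpoly = g.charpoly := by
  refine Polynomial.funext fun t => ?_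
  rw [LinearMap.eval_charpoly, LinearMap.eval_charpoly]
  have h1 : T * (algebraMap K _ t - f) = (algebraMap K _ t - g) * T := by
    rw [mul_sub, sub_mul, h, Algebra.commutes]
  have h2 := congrArg LinearMap.det h1
  rw [map_mul, map_mul, mul_comm] at h2
  exact (hT.map LinearMap.det).mul_right_cancel h2

open Polynomial in
theorem prod_fiber_eq_one_of_det_eq_one {K V ι : Type*} [Field K] [Infinite K] [DecidableEq K]
    [AddCommGroup V] [Module K V] [FiniteDimensional K V] [Fintype ι]
    {S : Subalgebra K (Module.End K V)} {χ : ι → (S →ₐ[K] K)}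
    (hχ : ∀ a : S, LinearMap.det (a : Module.End K V) = ∏ i, χ i a) (P Q : S)
    (hdet : ∀ p : K[X], IsIdempotentElem (aeval P p) →
      LinearMap.det ((aeval P p * Q + (1 - aeval P p) : S) : Module.End K V) = 1) (b : K) :
    ∏ i with χ i P = b, χ i Q = 1 := by
  rcases (Finset.univ.filter fun i => χ i P = b).eq_empty_or_nonempty with he | hne
  · simp [he]
  set k := (Finset.univ.filter fun i => χ i P = b).card with hk
  have hk0 : k ≠ 0 := hne.card_pos.ne'
  set g : K[X] := ∏ i with ¬ χ i P = b, (X - C (χ i P)) with hg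
  have hchar : LinearMap.charpoly (P : Module.End K V) = (X - C b) ^ k * g := by
    rw [Subalgebra.charpoly_eq_prod_characters hχ P,
      ← Finset.prod_filter_mul_prod_filter_not _ fun i => χ i P = b]
    congr 1
    rw [hk, ← Finset.prod_const]
    refine Finset.prod_congr rfl fun i hi => ?_
    rw [(Finset.mem_filter.mp hi).2]
  have hcop : IsCoprime ((X - C b) ^ k) g := by
    refine IsCoprime.pow_left (IsCoprime.prod_right fun i hi => ?_)
    exact isCoprime_X_sub_C_of_isUnit_sub
      (sub_ne_zero.mpr (Ne.symm (Finset.mem_filter.mp hi).2)).isUnit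
  obtain ⟨r, s, hrs⟩ := hcop
  have hzero : aeval P (LinearMap.charpoly (P : Module.End K V)) = 0 := by
    apply Subtype.ext
    have := LinearMap.aeval_self_charpoly (P : Module.End K V)
    exact (aeval_algHom_apply S.val P _).symm.trans this
  have hidem : IsIdempotentElem (aeval P (s * g)) := by
    have h1 : s * g - s * g * (s * g) = s * r * ((X - C b) ^ k * g) := by
      linear_combination (- (s * g)) * hrs
    have h2 := congrArg (aeval P) h1
    rw [map_mul (aeval P) (s * r), ← hchar, hzero, mul_zero, map_sub, map_mul (aeval P) (s * g),
      sub_eq_zero] at h2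
    exact h2.symm
  have hval : ∀ i, χ i (aeval P (s * g)) = if χ i P = b then 1 else 0 := by
    intro i
    rw [← aeval_algHom_apply, coe_aeval_eq_eval]
    split_ifs with h
    · have := congrArg (eval (χ i P)) hrs
      simpa [h, hk0] using this
    · rw [eval_mul, hg, eval_prod, Finset.prod_eq_zero (i := i) (by simpa using h) (by simp),
        mul_zero]
  have h1 := hdet _ hidem
  rw [hχ] at h1
  refine (Finset.prod_filter _ _).trans (Eq.trans ?_ h1)
  refine Finset.prod_congr rfl fun i _ => ?_
  rw [map_add, map_mul (χ i) (aeval P (s * g)), map_sub, map_one, hval]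
  split_ifs <;> simp

open Polynomial in
theorem exists_uniform_pow_roots_charpoly_eq_one (K V : Type) [Field K] [IsAlgClosed K]
    [AddCommGroup V] [Module K V] [FiniteDimensional K V] :
    ∃ m : ℕ, 0 < m ∧ ∀ P Q T : Module.End K V, IsUnit P → IsUnit Q → IsUnit T → P * Q = Q * P →
      T * P = P * Q * T →
      (∀ p : K[X], IsIdempotentElem (aeval P p) →
        LinearMap.det (aeval P p * Q + (1 - aeval P p)) = 1) →
      ∀ x ∈ Q.charpoly.roots, x ^ m = 1 := by
  classical
  have : Infinite K := IsAlgClosed.instInfinite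
  obtain ⟨m, hm, key⟩ := exists_uniform_pow_eq_one Kˣ (Fin (Module.finrank K V))
  refine ⟨m, hm, fun P Q T hP hQ hT hPQ hTP hdet x hx => ?_⟩
  have hcomm : ∀ a ∈ ({P, Q} : Set (Module.End K V)), ∀ b ∈ ({P, Q} : Set (Module.End K V)),
      a * b = b * a := by
    rintro a (rfl | rfl) b (rfl | rfl)
    exacts [rfl, hPQ, hPQ.symm, rfl]
  let S := Algebra.adjoin K ({P, Q} : Set (Module.End K V))
  have hS : ∀ x ∈ S, ∀ y ∈ S, x * y = y * x := by
    intro x hx y hy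
    have := Algebra.isMulCommutative_adjoin K hcomm
    exact congrArg Subtype.val (this.is_comm.comm (⟨x, hx⟩ : S) ⟨y, hy⟩)
  obtain ⟨χ, hχ⟩ := Subalgebra.exists_characters_det S hS
  let PS : S := ⟨P, Algebra.subset_adjoin (by simp)⟩
  let QS : S := ⟨Q, Algebra.subset_adjoin (by simp)⟩
  have hne : ∀ a : S, IsUnit (a : Module.End K V) → ∀ i, χ i a ≠ 0 := by
    intro a ha i h0
    have := (ha.map LinearMap.det).ne_zero
    rw [hχ] at this
    exact this (Finset.prod_eq_zero (Finset.mem_univ i) h0)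
  have hroots : ∀ a : S, (LinearMap.charpoly (a : Module.End K V)).roots =
      Finset.univ.val.map fun i => χ i a := by
    intro a
    rw [Subalgebra.charpoly_eq_prod_characters hχ]
    rw [← roots_multiset_prod_X_sub_C (Finset.univ.val.map fun i => χ i a), Multiset.map_map]
    rfl
  have hperm : Finset.univ.val.map (fun i => χ i (PS * QS)) =
      Finset.univ.val.map fun i => χ i PS := by
    rw [← hroots, ← hroots]
    exact congrArg _ (LinearMap.charpoly_eq_of_semiconj hT hTP).symm
  obtain ⟨σ, hσ⟩ := Finset.exists_perm_of_map_univ_eq hperm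
  have hall := key (fun i => Units.mk0 (χ i QS) (hne QS hQ i))
    (fun i => Units.mk0 (χ i PS) (hne PS hP i)) σ
    (fun i => Units.ext (by
      rw [Units.val_mul, Units.val_mk0, Units.val_mk0, Units.val_mk0, ← hσ i, map_mul, mul_comm]))
    (fun b => by
      have := prod_fiber_eq_one_of_det_eq_one hχ PS QS (fun p hp => by
        have e : ((aeval PS p : S) : Module.End K V) = aeval P p :=
          (aeval_algHom_apply S.val PS p).symm
        have h2 : IsIdempotentElem (aeval P p) := by
          rw [← e]; exact congrArg Subtype.val hp
        have := hdet p h2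
        rw [← e] at this
        exact this) (b : K)
      apply Units.ext
      rw [Units.coe_prod, Units.val_one, ← this]
      exact Finset.prod_congr (Finset.filter_congr fun i _ => by simp [Units.ext_iff])
        fun _ _ => rfl)
  have hx' : x ∈ (LinearMap.charpoly (QS : Module.End K V)).roots := hx
  rw [hroots] at hx'
  obtain ⟨i, -, rfl⟩ := Multiset.mem_map.mp hx'
  simpa [Units.ext_iff] using hall i

theorem exists_uniform_pow_roots_charpoly_eq_one_of_commutator {F : Type*} [Group F]
    {K V : Type} [Field K] [IsAlgClosed K] [AddCommGroup V] [Module K V] [FiniteDimensional K V]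
    (g : F →* Module.End K V)
    (h : ∀ u ∈ commutator F, ∃ P T : Module.End K V, IsUnit P ∧ IsUnit T ∧
      (∀ v, P * g v = g v * P) ∧ T * P = P * g u * T) :
    ∃ m : ℕ, 0 < m ∧ ∀ u ∈ commutator F, ∀ x ∈ (g u).charpoly.roots, x ^ m = 1 := by
  obtain ⟨m, hm, key⟩ := exists_uniform_pow_roots_charpoly_eq_one K V
  refine ⟨m, hm, fun u hu => ?_⟩
  obtain ⟨P, T, hP, hT, hPg, hTP⟩ := h u hu
  refine key P (g u) T hP ((Group.isUnit u).map g) hT (hPg u) hTP fun p hp => ?_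
  set π := Polynomial.aeval P p with hπ
  have hcomm : ∀ v, π * g v = g v * π := by
    intro v
    have hc : Commute P (g v) := hPg v
    rw [hπ, Polynomial.aeval_eq_sum_range, Finset.sum_mul, Finset.mul_sum]
    refine Finset.sum_congr rfl fun i _ => ?_
    rw [smul_mul_assoc, mul_smul_comm, (hc.pow_left i).eq]
  have hmul : ∀ v w, π * g (v * w) + (1 - π) = (π * g v + (1 - π)) * (π * g w + (1 - π)) := by
    intro v w
    have h1 : π * π = π := hp
    have h2 : π * g v * (π * g w) = π * g (v * w) := by
      rw [mul_assoc, ← mul_assoc (g v), ← hcomm, mul_assoc π, ← mul_assoc, h1, map_mul]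
    have h3 : (1 - π) * (π * g w) = 0 := by
      rw [← mul_assoc, sub_mul, one_mul, h1, sub_self, zero_mul]
    have h4 : π * g v * (1 - π) = 0 := by
      rw [hcomm, mul_assoc, mul_sub, mul_one, h1, sub_self, mul_zero]
    have h5 : (1 - π) * (1 - π) = 1 - π := by rw [mul_sub, mul_one, sub_mul, one_mul, h1]; simp
    rw [add_mul, mul_add, mul_add, h2, h3, h4, h5]; simp
  let D : F →* K :=
    { toFun := fun v => LinearMap.det (π * g v + (1 - π))
      map_one' := by simp
      map_mul' := fun v w => by rw [hmul, map_mul] }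
  have hker : commutator F ≤ D.toHomUnits.ker := Abelianization.commutator_subset_ker _
  have := hker hu
  rw [MonoidHom.mem_ker, Units.ext_iff] at this
  exact this

section Engel

/-- The iterated commutator `[⋯[[x, y], y]⋯, y]` with `n` occurrences of `y`. -/
def engelWord {G : Type*} [Group G] (x y : G) : ℕ → G
  | 0 => x
  | n + 1 => engelWord x y n * y * (engelWord x y n)⁻¹ * y⁻¹

theorem map_engelWord {G H : Type*} [Group G] [Group H] (f : G →* H) (x y : G) (n : ℕ) :
    f (engelWord x y n) = engelWord (f x) (f y) n := by
  induction n with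
  | zero => rfl
  | succ n ih => simp only [engelWord, map_mul, map_inv, ih]

theorem map_engelWord_sub_one_mem_pow {G B : Type*} [Group G] [Ring B] (J : Ideal B)
    [J.IsTwoSided] (g : G →* B) {x y : G} (hx : g x - 1 ∈ J) (hy : g y - 1 ∈ J) (n : ℕ) :
    g (engelWord x y n) - 1 ∈ J ^ (n + 1) := by
  induction n with
  | zero => simpa [engelWord, Submodule.pow_one] using hx
  | succ n ih =>
    set z := engelWord x y n with hz
    have h1 : g (z * y * z⁻¹ * y⁻¹) - 1 =
        ((g z - 1) * (g y - 1) - (g y - 1) * (g z - 1)) * g (z⁻¹ * y⁻¹) := by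
      have h2 : g y * g z * g (z⁻¹ * y⁻¹) = 1 := by
        rw [← map_mul, ← map_mul, ← map_one g]; congr 1; group
      have h3 : g z * g y * g (z⁻¹ * y⁻¹) = g (z * y * z⁻¹ * y⁻¹) := by
        rw [← map_mul, ← map_mul]; congr 1; group
      have h4 : (g z - 1) * (g y - 1) - (g y - 1) * (g z - 1) = g z * g y - g y * g z := by
        noncomm_ring
      rw [h4, sub_mul, h2, h3]
    change g (z * y * z⁻¹ * y⁻¹) - 1 ∈ _
    rw [h1]
    refine Ideal.mul_mem_right _ _ (sub_mem ?_ ?_)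
    · rw [Submodule.pow_succ]; exact Ideal.mul_mem_mul ih hy
    · rw [Ideal.IsTwoSided.pow_succ]; exact Ideal.mul_mem_mul hy ih

end Engel

open Polynomial in
theorem isNilpotent_of_forall_trace_pow_eq_zero {K V : Type*} [Field K] [CharZero K]
    [AddCommGroup V] [Module K V] [FiniteDimensional K V] (a : Module.End K V)
    (h : ∀ k, LinearMap.trace K V (a ^ (k + 1)) = 0) : IsNilpotent a := by
  obtain ⟨g, hg, hdvd⟩ := exists_eq_pow_rootMultiplicity_mul_and_not_dvd a.charpoly
    a.charpoly_monic.ne_zero 0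
  rw [C_0, sub_zero] at hg hdvd
  set k := a.charpoly.rootMultiplicity 0
  have hcop : IsCoprime (X ^ (k + 1)) g :=
    IsCoprime.pow_left ((irreducible_X.coprime_iff_not_dvd).mpr hdvd)
  obtain ⟨s, r, hsr⟩ := hcop
  have h0 : aeval a (X ^ k * g) = 0 := by rw [← hg]; exact a.aeval_self_charpoly
  set e := aeval a (s * X ^ (k + 1)) with he
  have hidem : IsIdempotentElem e := by
    have h1 : s * X ^ (k + 1) - s * X ^ (k + 1) * (s * X ^ (k + 1)) =
        s * X * r * (X ^ k * g) := by
      linear_combination (- (s * X ^ (k + 1))) * hsr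
    have h2 := congrArg (aeval a) h1
    rw [map_mul (aeval a) (s * X * r), h0, mul_zero, map_sub, map_mul (aeval a) (s * X ^ (k + 1)),
      sub_eq_zero] at h2
    exact h2.symm
  have htr : LinearMap.trace K V e = 0 := by
    rw [he, mul_comm, pow_succ', mul_assoc]
    generalize X ^ k * s = q
    rw [map_mul, aeval_X, aeval_eq_sum_range, Finset.mul_sum, map_sum]
    refine Finset.sum_eq_zero fun i _ => ?_
    rw [mul_smul_comm, ← pow_succ', map_smul, h, smul_zero]
  have he0 : e = 0 := (LinearMap.IsIdempotentElem.trace_eq_zero_iff hidem).mp htr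
  refine ⟨k, ?_⟩
  have h3 := congrArg (aeval a) hsr
  rw [map_add, ← he, he0, zero_add, map_one] at h3
  have h4 : aeval a (X ^ k * (r * g)) = 0 := by
    rw [mul_left_comm, map_mul, h0, mul_zero]
  rw [map_mul, h3, mul_one, map_pow, aeval_X] at h4
  exact h4

open Polynomial in
theorem dvd_pow_of_roots_pow_eq_one {K : Type*} [Field K] [IsAlgClosed K] {m d : ℕ}
    {f : K[X]} (hf : f.Monic) (hd : f.natDegree ≤ d) (h : ∀ x ∈ f.roots, x ^ m = 1) :
    f ∣ (X ^ m - 1) ^ d := by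
  have hs := (IsAlgClosed.splits f).eq_prod_roots_of_monic hf
  refine Dvd.dvd.trans ?_ (pow_dvd_pow _ ((Polynomial.card_roots' f).trans hd))
  conv_lhs => rw [hs]
  have : ∀ s : Multiset K, (∀ x ∈ s, x ^ m = 1) →
      (s.map fun x => X - C x).prod ∣ ((X : K[X]) ^ m - 1) ^ s.card := by
    intro s
    induction s using Multiset.induction with
    | empty => simp
    | cons a s ih =>
      intro h
      rw [Multiset.map_cons, Multiset.prod_cons, Multiset.card_cons, pow_succ']
      refine mul_dvd_mul (dvd_iff_isRoot.mpr ?_) (ih fun x hx => h x (Multiset.mem_cons_of_mem hx))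
      simp [h a (Multiset.mem_cons_self a s)]
  exact this _ h

open Polynomial in
theorem exists_uniform_pow_eq_one_of_charP {D K V : Type*} [Group D] [Field K] [IsAlgClosed K]
    [AddCommGroup V] [Module K V] [FiniteDimensional K V] (g : D →* Module.End K V) (p : ℕ)
    [Fact p.Prime] [CharP K p] {m : ℕ} (hm : 0 < m)
    (h : ∀ u, ∀ x ∈ (g u).charpoly.roots, x ^ m = 1) : ∃ k : ℕ, 0 < k ∧ ∀ u, g (u ^ k) = 1 := by
  set d := Module.finrank K V
  have hp : p.Prime := Fact.out
  refine ⟨m * p ^ d, Nat.mul_pos hm (pow_pos hp.pos d), fun u => ?_⟩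
  have h1 := dvd_pow_of_roots_pow_eq_one (d := p ^ d) (g u).charpoly_monic
    ((LinearMap.charpoly_natDegree (g u)).trans_le (Nat.lt_pow_self hp.one_lt).le) (h u)
  rw [sub_pow_char_pow, one_pow, ← pow_mul] at h1
  obtain ⟨q, hq⟩ := h1
  have h2 := congrArg (aeval (g u)) hq
  rw [map_mul, (g u).aeval_self_charpoly, zero_mul, map_sub, map_pow, aeval_X, map_one,
    sub_eq_zero] at h2
  rw [map_pow, h2]

theorem finite_setOf_trace_of_roots_pow_eq_one {K V : Type*} [Field K] [IsAlgClosed K]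
    [AddCommGroup V] [Module K V] [FiniteDimensional K V] {m : ℕ} (hm : 0 < m) :
    {t : K | ∃ f : Module.End K V, (∀ x ∈ f.charpoly.roots, x ^ m = 1) ∧
      LinearMap.trace K V f = t}.Finite := by
  classical
  set d := Module.finrank K V
  refine ((Multiset.powerset (d • (Polynomial.nthRootsFinset m (1 : K)).val)).toFinset.image
    Multiset.sum).finite_toSet.subset ?_
  rintro t ⟨f, hf, rfl⟩
  rw [Module.End.trace_eq_sum_roots_charpoly_of_splits (IsAlgClosed.splits _)]
  simp only [Finset.coe_image, Set.mem_image, Finset.mem_coe, Multiset.mem_toFinset,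
    Multiset.mem_powerset]
  refine ⟨_, Multiset.le_iff_count.mpr fun a => ?_, rfl⟩
  by_cases ha : a ∈ f.charpoly.roots
  · have h1 : a ∈ (Polynomial.nthRootsFinset m (1 : K)).val :=
      (Polynomial.mem_nthRootsFinset hm 1).mpr (hf a ha)
    rw [Multiset.count_nsmul, Multiset.count_eq_one_of_mem (Finset.nodup _) h1, mul_one]
    exact (Multiset.count_le_card _ _).trans
      ((Polynomial.card_roots' _).trans (LinearMap.charpoly_natDegree f).le)
  · simp [Multiset.count_eq_zero_of_notMem ha]

theorem exists_pow_forall_trace_eq {D K V : Type*} [Group D] [Field K]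
    [AddCommGroup V] [Module K V] [FiniteDimensional K V] (g : D →* Module.End K V)
    (hfin : (Set.range fun u => LinearMap.trace K V (g u)).Finite) (x : D) :
    ∃ k : ℕ, 0 < k ∧ ∀ b ∈ Submodule.span K (Set.range g),
      LinearMap.trace K V ((g (x ^ k) - 1) * b) = 0 := by
  obtain ⟨f, hf, hspan, -⟩ := Submodule.exists_fun_fin_finrank_span_eq K (Set.range g)
  choose w hw using hf
  let T : Set K := Set.range fun u => LinearMap.trace K V (g u)
  have : Finite T := hfin
  let Φ : ℕ → (Fin (Module.finrank K (Submodule.span K (Set.range g))) → T) :=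
    fun k i => ⟨LinearMap.trace K V (g (x ^ k * w i)), x ^ k * w i, rfl⟩
  obtain ⟨a, c, hac, hΦ⟩ := Finite.exists_ne_map_eq_of_infinite Φ
  have main : ∀ a c : ℕ, a < c → Φ a = Φ c → ∃ k : ℕ, 0 < k ∧
      ∀ b ∈ Submodule.span K (Set.range g), LinearMap.trace K V ((g (x ^ k) - 1) * b) = 0 := by
    intro a c hac hΦ
    refine ⟨c - a, Nat.sub_pos_of_lt hac, ?_⟩
    have h1 : ∀ b ∈ Submodule.span K (Set.range g),
        LinearMap.trace K V ((g (x ^ c) - g (x ^ a)) * b) = 0 := by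
      intro b hb
      rw [← hspan] at hb
      induction hb using Submodule.span_induction with
      | mem b hb =>
        obtain ⟨i, rfl⟩ := hb
        have := congrArg Subtype.val (congrFun hΦ i)
        simp only [Φ] at this
        rw [← hw i, sub_mul, ← map_mul, ← map_mul, map_sub, this, sub_self]
      | zero => simp
      | add b c _ _ hb hc => rw [mul_add, map_add, hb, hc, add_zero]
      | smul r b _ hb => rw [mul_smul_comm, map_smul, hb, smul_zero]
    intro b hb
    have h2 : g (x ^ a)⁻¹ * b ∈ Submodule.span K (Set.range g) := by
      induction hb using Submodule.span_induction with
      | mem b hb =>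
        obtain ⟨i, rfl⟩ := hb
        exact Submodule.subset_span ⟨(x ^ a)⁻¹ * i, map_mul _ _ _⟩
      | zero => simp
      | add b c _ _ hb hc => rw [mul_add]; exact add_mem hb hc
      | smul r b _ hb => rw [mul_smul_comm]; exact Submodule.smul_mem _ _ hb
    have h3 := h1 _ h2
    rw [← mul_assoc, sub_mul, ← map_mul, ← map_mul, mul_inv_cancel, map_one,
      ← pow_sub x hac.le] at h3
    exact h3
  rcases lt_or_gt_of_ne hac with h | h
  · exact main a c h hΦ
  · exact main c a h hΦ.symm

theorem exists_map_engelWord_eq_one {D K V : Type*} [Group D] [Field K] [CharZero K]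
    [AddCommGroup V] [Module K V] [FiniteDimensional K V] (g : D →* Module.End K V)
    (hfin : (Set.range fun u => LinearMap.trace K V (g u)).Finite) (x y : D) :
    ∃ k l n : ℕ, 0 < k ∧ 0 < l ∧ g (engelWord (x ^ k) (y ^ l) n) = 1 := by
  obtain ⟨k, hk, hxk⟩ := exists_pow_forall_trace_eq g hfin x
  obtain ⟨l, hl, hyl⟩ := exists_pow_forall_trace_eq g hfin y
  let B : Subalgebra K (Module.End K V) := Algebra.adjoin K (MonoidHom.mrange g)
  have hB : Subalgebra.toSubmodule B = Submodule.span K (Set.range g) := by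
    rw [Algebra.adjoin_eq_span, Submonoid.closure_eq]; rfl
  let gB : D →* B := g.codRestrict B.toSubmonoid fun u => Algebra.subset_adjoin ⟨u, rfl⟩
  have : IsArtinianRing B := isArtinian_of_tower K inferInstance
  have hJ : ∀ a : B, (∀ b ∈ Submodule.span K (Set.range g),
      LinearMap.trace K V ((a : Module.End K V) * b) = 0) → a ∈ Ideal.jacobson (⊥ : Ideal B) := by
    intro a ha
    rw [Ideal.mem_jacobson_iff]
    intro b
    have hnil : IsNilpotent (b * a) := by
      have : IsNilpotent ((b * a : B) : Module.End K V) := by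
        refine isNilpotent_of_forall_trace_pow_eq_zero _ fun j => ?_
        have h1 : (((b * a : B) : Module.End K V)) ^ (j + 1) =
            (b : Module.End K V) * ((a : Module.End K V) * ((b * a) ^ j : B)) := by
          rw [pow_succ']; push_cast; rw [mul_assoc]
        rw [h1, LinearMap.trace_mul_comm, mul_assoc]
        apply ha
        rw [← hB]
        exact ((b * a) ^ j * b : B).2
      obtain ⟨j, hj⟩ := this
      exact ⟨j, Subtype.ext (by simpa using hj)⟩
    obtain ⟨u, hu⟩ := hnil.isUnit_one_add
    refine ⟨(u⁻¹ : Bˣ), ?_⟩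
    have h1 : (u⁻¹ : Bˣ) * (1 + b * a) = 1 := by rw [← hu, Units.inv_mul]
    rw [Ideal.mem_bot, ← h1]
    noncomm_ring
  obtain ⟨n, hn⟩ := IsArtinianRing.isNilpotent_jacobson_bot (R := B)
  refine ⟨k, l, n, hk, hl, ?_⟩
  have : (Ideal.jacobson (⊥ : Ideal B)).IsTwoSided := inferInstance
  have h2 := map_engelWord_sub_one_mem_pow _ gB (hJ (gB (x ^ k) - 1) hxk)
    (hJ (gB (y ^ l) - 1) hyl) n
  have h3 := Ideal.pow_le_pow_right n.le_succ h2
  rw [hn] at h3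
  have h4 : gB (engelWord (x ^ k) (y ^ l) n) = 1 := sub_eq_zero.mp h3
  exact congrArg Subtype.val h4

section IA

theorem MulAut.mul_conj {G : Type*} [Group G] (φ : MulAut G) (w : G) :
    φ * MulAut.conj w = MulAut.conj (φ w) * φ := by
  ext x
  simp [MulAut.conj_apply]

theorem MulAut.conj_mem_IA {n : ℕ} (w : FreeGroup (Fin n)) : MulAut.conj w ∈ IA n := by
  intro x
  rw [MulAut.conj_apply, map_mul, map_mul, mul_right_comm, map_inv, mul_inv_cancel, one_mul]

/-- Inner automorphisms of `Fₙ`, as elements of `IA(Fₙ)`. -/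
def conjIA (n : ℕ) : FreeGroup (Fin n) →* IA n :=
  MulAut.conj.codRestrict (IA n) MulAut.conj_mem_IA

/-- The endomorphism of a free group sending the generator `c` to `w⁻¹ * c` and fixing the other
generators. -/
def leftTransvection {α : Type*} [DecidableEq α] (c : α) (w : FreeGroup α) :
    FreeGroup α →* FreeGroup α :=
  FreeGroup.lift (Function.update FreeGroup.of c (w⁻¹ * FreeGroup.of c))

section leftTransvection

variable {α β : Type*} [DecidableEq α] {c : α} {e : β → α}

theorem leftTransvection_of_self (w : FreeGroup α) :
    leftTransvection c w (FreeGroup.of c) = w⁻¹ * FreeGroup.of c := by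
  simp [leftTransvection]

theorem leftTransvection_map (he : ∀ b, e b ≠ c) (w : FreeGroup α) (v : FreeGroup β) :
    leftTransvection c w (FreeGroup.map e v) = FreeGroup.map e v := by
  have : (leftTransvection c w).comp (FreeGroup.map e) = FreeGroup.map e := by
    ext b
    simp [leftTransvection, Function.update_of_ne (he b)]
  exact DFunLike.congr_fun this v

theorem leftTransvection_comp (he : ∀ b, e b ≠ c) {u v : FreeGroup β} (huv : u * v = 1) :
    (leftTransvection c (FreeGroup.map e u)).comp (leftTransvection c (FreeGroup.map e v)) =
      MonoidHom.id _ := by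
  ext a
  by_cases ha : a = c
  · subst ha
    rw [MonoidHom.comp_apply, leftTransvection_of_self, map_mul, leftTransvection_of_self, map_inv,
      leftTransvection_map he, ← mul_assoc, ← mul_inv_rev, ← map_mul, huv]
    simp
  · simp [leftTransvection, Function.update_of_ne ha]

theorem abelianization_leftTransvection {w : FreeGroup α} (hw : w ∈ commutator (FreeGroup α))
    (x : FreeGroup α) :
    Abelianization.of (leftTransvection c w x) = Abelianization.of x := by
  have h1 : Abelianization.of w = 1 := by
    rwa [← MonoidHom.mem_ker, Abelianization.ker_of]
  have : Abelianization.of.comp (leftTransvection c w) = Abelianization.of := by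
    ext a
    by_cases ha : a = c
    · subst ha
      rw [MonoidHom.comp_apply, leftTransvection_of_self, map_mul, map_inv, h1, inv_one, one_mul]
    · simp [leftTransvection, Function.update_of_ne ha]
  exact DFunLike.congr_fun this x

end leftTransvection

theorem exists_commute_conjIA {β : Type*} {n : ℕ} {c : Fin n} {e : β → Fin n}
    (he : ∀ b, e b ≠ c) {u : FreeGroup β} (hu : u ∈ commutator (FreeGroup β)) :
    ∃ P : IA n, (∀ v, P * conjIA n (FreeGroup.map e v) = conjIA n (FreeGroup.map e v) * P) ∧
      conjIA n (FreeGroup.of c) * P =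
        P * conjIA n (FreeGroup.map e u) * conjIA n (FreeGroup.of c) := by
  have hu' := Abelianization.commutator_subset_ker (Abelianization.of.comp (FreeGroup.map e)) hu
  rw [MonoidHom.mem_ker, MonoidHom.comp_apply, ← MonoidHom.mem_ker, Abelianization.ker_of] at hu'
  let φ : MulAut (FreeGroup (Fin n)) := MonoidHom.toMulEquiv
    (leftTransvection c (FreeGroup.map e u)) (leftTransvection c (FreeGroup.map e u⁻¹))
    (leftTransvection_comp he (inv_mul_cancel u)) (leftTransvection_comp he (mul_inv_cancel u))
  have hcomm : ∀ v, φ * MulAut.conj (FreeGroup.map e v) = MulAut.conj (FreeGroup.map e v) * φ := by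
    intro v
    rw [MulAut.mul_conj]
    congr 2
    exact leftTransvection_map he _ v
  have hc : φ (FreeGroup.of c) = (FreeGroup.map e u)⁻¹ * FreeGroup.of c :=
    leftTransvection_of_self _
  refine ⟨⟨φ, abelianization_leftTransvection hu'⟩, fun v => Subtype.ext (hcomm v),
    Subtype.ext ?_⟩
  change MulAut.conj (FreeGroup.of c) * φ =
    φ * MulAut.conj (FreeGroup.map e u) * MulAut.conj (FreeGroup.of c)
  rw [hcomm, mul_assoc, MulAut.mul_conj φ, hc, map_mul, map_inv, ← mul_assoc, mul_inv_cancel_left]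

end IA

section Matrices

open Matrix

/-- The upper unitriangular `2 × 2` matrix with corner entry `s`. -/
def upperUnipotent (s : ℚ) : (Matrix (Fin 2) (Fin 2) ℚ)ˣ where
  val := !![1, s; 0, 1]
  inv := !![1, -s; 0, 1]
  val_inv := by simp [Matrix.one_fin_two]
  inv_val := by simp [Matrix.one_fin_two]

/-- The diagonal matrix with entries `2 ^ l`, `2 ^ (-l)`. -/
def dyadicDiagonal (l : ℕ) : (Matrix (Fin 2) (Fin 2) ℚ)ˣ where
  val := !![2 ^ l, 0; 0, (2 ^ l)⁻¹]
  inv := !![(2 ^ l)⁻¹, 0; 0, 2 ^ l]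
  val_inv := by simp [Matrix.one_fin_two]
  inv_val := by simp [Matrix.one_fin_two]

theorem upperUnipotent_pow (s : ℚ) (k : ℕ) : upperUnipotent s ^ k = upperUnipotent (k * s) := by
  induction k with
  | zero => ext i j; fin_cases i <;> fin_cases j <;> simp [upperUnipotent]
  | succ k ih =>
    rw [pow_succ, ih]
    ext i j
    fin_cases i <;> fin_cases j <;> simp [upperUnipotent, Matrix.mul_apply]
    ring

theorem dyadicDiagonal_pow (l : ℕ) : dyadicDiagonal 1 ^ l = dyadicDiagonal l := by
  induction l with
  | zero => ext i j; fin_cases i <;> fin_cases j <;> simp [dyadicDiagonal]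
  | succ l ih =>
    rw [pow_succ, ih]
    ext i j
    fin_cases i <;> fin_cases j <;> simp [dyadicDiagonal, Matrix.mul_apply, pow_succ, mul_comm]

theorem engelWord_upperUnipotent (s : ℚ) (l n : ℕ) :
    engelWord (upperUnipotent s) (dyadicDiagonal l) n =
      upperUnipotent (s * (1 - (2 ^ l) ^ 2) ^ n) := by
  induction n with
  | zero => simp [engelWord]
  | succ n ih =>
    rw [engelWord, ih, mul_inv_eq_iff_eq_mul, mul_inv_eq_iff_eq_mul]
    ext i j
    fin_cases i <;> fin_cases j <;> simp [upperUnipotent, dyadicDiagonal, Matrix.mul_apply]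
    field_simp
    ring

theorem eq_zero_of_commute_dyadicDiagonal {s : ℚ}
    (h : Commute (upperUnipotent s) (dyadicDiagonal 1)) : s = 0 := by
  have h1 : (upperUnipotent s * dyadicDiagonal 1).val 0 1 =
      (dyadicDiagonal 1 * upperUnipotent s).val 0 1 := by rw [h.eq]
  simp [upperUnipotent, dyadicDiagonal] at h1
  linarith

open scoped commutatorElement in
theorem exists_commutator_map_eq_upperUnipotent :
    ∃ (θ : FreeGroup (Fin 2) →* (Matrix (Fin 2) (Fin 2) ℚ)ˣ) (x y : FreeGroup (Fin 2)),
      x ∈ commutator (FreeGroup (Fin 2)) ∧ y ∈ commutator (FreeGroup (Fin 2)) ∧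
      θ x = upperUnipotent (3 / 2) ∧ θ y = dyadicDiagonal 1 := by
  let A : (Matrix (Fin 2) (Fin 2) ℚ)ˣ :=
    ⟨!![-2, 3; 1, -1], !![1, 3; 1, 2], by rw [Matrix.one_fin_two, Matrix.mul_fin_two]; norm_num,
      by rw [Matrix.one_fin_two, Matrix.mul_fin_two]; norm_num⟩
  let B : (Matrix (Fin 2) (Fin 2) ℚ)ˣ :=
    ⟨!![1, 1; 0, 2], !![1, -1 / 2; 0, 1 / 2],
      by rw [Matrix.one_fin_two, Matrix.mul_fin_two]; norm_num,
      by rw [Matrix.one_fin_two, Matrix.mul_fin_two]; norm_num⟩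
  let a : FreeGroup (Fin 2) := FreeGroup.of 0
  let b : FreeGroup (Fin 2) := FreeGroup.of 1
  let θ : FreeGroup (Fin 2) →* (Matrix (Fin 2) (Fin 2) ℚ)ˣ := FreeGroup.lift ![A, B]
  have ha : θ a = A := by simp [θ, a]
  have hb : θ b = B := by simp [θ, b]
  have hmem : ∀ u v : FreeGroup (Fin 2), ⁅u, v⁆ ∈ commutator (FreeGroup (Fin 2)) := fun u v =>
    Subgroup.commutator_mem_commutator (Subgroup.mem_top u) (Subgroup.mem_top v)
  have hy : θ ⁅a, b⁆ = dyadicDiagonal 1 := by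
    rw [map_commutatorElement, ha, hb, commutatorElement_def, mul_inv_eq_iff_eq_mul,
      mul_inv_eq_iff_eq_mul]
    ext i j
    fin_cases i <;> fin_cases j <;> norm_num [A, B, dyadicDiagonal, Matrix.mul_apply]
  refine ⟨θ, ⁅⁅a, b⁆, b⁆, ⁅a, b⁆, hmem _ _, hmem _ _, ?_, hy⟩
  rw [map_commutatorElement, hy, hb, commutatorElement_def, mul_inv_eq_iff_eq_mul,
    mul_inv_eq_iff_eq_mul]
  ext i j
  fin_cases i <;> fin_cases j <;>
    norm_num [B, dyadicDiagonal, upperUnipotent, Matrix.mul_apply]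

end Matrices

/-- If all eigenvalues of a linear representation are roots of unity of bounded order, then some
Engel word in powers of two given elements lies in the kernel. -/
theorem exists_engelWord_map_eq_one {D K V : Type*} [Group D] [Field K] [IsAlgClosed K]
    [AddCommGroup V] [Module K V] [FiniteDimensional K V] (g : D →* Module.End K V) {m : ℕ}
    (hm : 0 < m) (h : ∀ u, ∀ x ∈ (g u).charpoly.roots, x ^ m = 1) (x y : D) :
    ∃ k l n : ℕ, 0 < k ∧ 0 < l ∧ g (engelWord (x ^ k) (y ^ l) n) = 1 := by
  obtain ⟨p, hp⟩ := CharP.exists K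
  rcases CharP.char_is_prime_or_zero K p with hprime | rfl
  · have : Fact p.Prime := ⟨hprime⟩
    obtain ⟨k, hk, hk1⟩ := exists_uniform_pow_eq_one_of_charP g p hm h
    exact ⟨k, 1, 0, hk, one_pos, hk1 x⟩
  · have : CharZero K := CharP.charP_to_charZero K
    refine exists_map_engelWord_eq_one g
      ((finite_setOf_trace_of_roots_pow_eq_one (V := V) hm).subset ?_) x y
    rintro _ ⟨u, rfl⟩
    exact ⟨g u, h u, rfl⟩

theorem HasFaithfulRep.exists_injective_end {L : Type*} [Group L] {K : Type} [Field K]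
    (h : HasFaithfulRep L K) : ∃ (N : ℕ)
      (ρ : L →* Module.End (AlgebraicClosure K) (Fin N → AlgebraicClosure K)),
      Function.Injective ρ := by
  obtain ⟨N, f, hf⟩ := h
  refine ⟨N, ((Matrix.toLinAlgEquiv' : Matrix (Fin N) (Fin N) (AlgebraicClosure K) ≃ₐ[_] _) :
    _ →* _).comp ((algebraMap K (AlgebraicClosure K)).mapMatrix.toMonoidHom.comp
      ((Units.coeHom _).comp f)), ?_⟩
  intro a b hab
  apply hf
  have h1 := Matrix.toLinAlgEquiv'.injective hab
  exact Units.ext (Matrix.map_injective (algebraMap K (AlgebraicClosure K)).injective h1)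

/-- For all `n ≥ 3`, `IA(Fₙ)` is not linear. -/
theorem IA_not_linear_of_three_le (n : ℕ) (hn : 3 ≤ n) : ¬ IsLinear (IA n) := by
  rintro ⟨K, inst, hK⟩
  obtain ⟨N, ρ, hρ⟩ := hK.exists_injective_end
  let e : Fin 2 → Fin n := Fin.castLE (by omega)
  have he : ∀ b, e b ≠ ⟨2, hn⟩ := fun b =>
    Fin.ne_of_val_ne (by simp only [e, Fin.val_castLE]; omega)
  let g : FreeGroup (Fin 2) →* Module.End (AlgebraicClosure K) (Fin N → AlgebraicClosure K) :=
    ρ.comp ((conjIA n).comp (FreeGroup.map e))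
  obtain ⟨m, hm, hroots⟩ := exists_uniform_pow_roots_charpoly_eq_one_of_commutator g (by
    intro u hu
    obtain ⟨P, hP, hPT⟩ := exists_commute_conjIA he hu
    refine ⟨ρ P, ρ (conjIA n (FreeGroup.of ⟨2, hn⟩)), (Group.isUnit _).map ρ,
      (Group.isUnit _).map ρ, fun v => ?_, ?_⟩
    · simp only [g, MonoidHom.comp_apply, ← map_mul ρ, hP]
    · simp only [g, MonoidHom.comp_apply, ← map_mul ρ, hPT])
  obtain ⟨θ, x, y, hx, hy, hθx, hθy⟩ := exists_commutator_map_eq_upperUnipotent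
  obtain ⟨k, l, r, hk, hl, hE⟩ := exists_engelWord_map_eq_one
    (g.comp (commutator (FreeGroup (Fin 2))).subtype) hm (fun u => hroots u u.2) ⟨x, hx⟩ ⟨y, hy⟩
  rw [MonoidHom.comp_apply, map_engelWord, map_pow, map_pow] at hE
  change g (engelWord (x ^ k) (y ^ l) r) = 1 at hE
  have h1 : conjIA n (FreeGroup.map e (engelWord (x ^ k) (y ^ l) r)) = 1 :=
    hρ (hE.trans (map_one ρ).symm)
  have h2 : Commute (engelWord (x ^ k) (y ^ l) r) y := by
    have h3 := DFunLike.congr_fun (congrArg Subtype.val h1) (FreeGroup.map e y)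
    apply FreeGroup.map_injective (Fin.castLE_injective (by omega : 2 ≤ n))
    rw [map_mul, map_mul]
    exact mul_inv_eq_iff_eq_mul.mp h3
  have h4 := h2.map θ
  rw [map_engelWord, map_pow, map_pow, hθx, hθy, upperUnipotent_pow, dyadicDiagonal_pow,
    engelWord_upperUnipotent] at h4
  have h5 := eq_zero_of_commute_dyadicDiagonal h4
  have h6 : (1 : ℚ) < 2 ^ l := one_lt_pow₀ (by norm_num) hl.ne'
  have h7 : (1 : ℚ) - (2 ^ l) ^ 2 ≠ 0 := by nlinarith
  have h8 : (k : ℚ) ≠ 0 := by exact_mod_cast hk.ne'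
  exact mul_ne_zero (mul_ne_zero h8 (by norm_num)) (pow_ne_zero r h7) h5
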